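/- arXiv:2503.21917 — 5 statements merged into one kernel-verified Lean document; each statement's English description precedes it below -/
import Mathlib

section
/- Let n ≥ 1, let g = (g^{ij}) be a constant invertible symmetric real n×n matrix with inverse entries (g_{ij}), and let c^{ij}_k, f^{ij} (1 ≤ i,j,k ≤ n) be real constants satisfying: (i) c^{ij}_k = −c^{ji}_k and f^{ij} = −f^{ji}; (ii) the Jacobi identity Σ_s (c^{ij}_s c^{sk}_ℓ + c^{jk}_s c^{si}_ℓ + c^{ki}_s c^{sj}_ℓ) = 0 for all i,j,k,ℓ; (iii) the 2-cocycle condition Σ_s (f^{is} c^{jk}_s + f^{js} c^{ki}_s + f^{ks} c^{ij}_s) = 0 for all i,j,k; and (iv) the compatibility condition Σ_s (g^{is} c^{jk}_s + g^{js} c^{ik}_s) = 0 for all i,j,k. Define the (1,1)-tensor field L^i_j : ℝⁿ → ℝ by L^i_j(u) = Σ_s g_{js} (Σ_ℓ c^{si}_ℓ u^ℓ + f^{si}). Then the Nijenhuis torsion N^k_{ij}(u) = Σ_s ( L^s_i(u) ∂L^k_j/∂u^s − L^s_j(u) ∂L^k_i/∂u^s + L^k_s(u) ∂L^s_i/∂u^j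 − L^k_s(u) ∂L^s_j/∂u^i ) vanishes for all u ∈ ℝⁿ and all indices i,j,k if and only if Σ_s c^{is}_j c^{kℓ}_s = 0 for all i,j,k,ℓ and Σ_s f^{is} c^{jk}_s = 0 for all i,j,k. -/
open scoped BigOperators

/-- Partial derivative in the `i`-th coordinate direction on `ℝⁿ`. -/
noncomputable def pd {n : ℕ} (i : Fin n) (f : (Fin n → ℝ) → ℝ) : (Fin n → ℝ) → ℝ :=
  fun u => fderiv ℝ f u (Pi.single i 1)

/-- The invariance of `g` makes `∑ m, g b m * c a s m` cyclically symmetric in `b`, `a`, `s`. -/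
lemma sum_mul_structureConst_cyclic {ι : Type*} [Fintype ι] {g : Matrix ι ι ℝ}
    {c : ι → ι → ι → ℝ} (hc_skew : ∀ i j k, c i j k = - c j i k)
    (h_compat : ∀ i j k, ∑ s, (g i s * c j k s + g j s * c i k s) = 0) (a b s : ι) :
    ∑ m, g b m * c a s m = ∑ m, g s m * c b a m := by
  have h := h_compat b s a
  simp only [Finset.sum_add_distrib] at h
  have h' : ∑ m, g b m * c a s m = -∑ m, g b m * c s a m := by
    rw [← Finset.sum_neg_distrib]
    exact Finset.sum_congr rfl fun m _ => by rw [hc_skew a s m]; ring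
  linarith

/-- The Jacobi identity and the cocycle condition combine to a cocycle condition for the
affine bracket `c i j l * u l + f i j`. -/
lemma affine_bracket_cocycle {ι : Type*} [Fintype ι]
    {c : ι → ι → ι → ℝ} {f : ι → ι → ℝ} (hc_skew : ∀ i j k, c i j k = - c j i k)
    (h_jacobi : ∀ i j k l,
      ∑ s, (c i j s * c s k l + c j k s * c s i l + c k i s * c s j l) = 0)
    (h_cocycle : ∀ i j k,
      ∑ s, (f i s * c j k s + f j s * c k i s + f k s * c i j s) = 0)
    (u : ι → ℝ) (i j k : ι) :
    ∑ s, (((∑ l, c i s l * u l) + f i s) * c j k s + ((∑ l, c j s l * u l) + f j s) * c k i s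
      + ((∑ l, c k s l * u l) + f k s) * c i j s) = 0 := by
  have h : ∑ s, ((∑ l, c i s l * u l) * c j k s + (∑ l, c j s l * u l) * c k i s
      + (∑ l, c k s l * u l) * c i j s) = 0 := by
    simp only [Finset.sum_mul, ← Finset.sum_add_distrib]
    rw [Finset.sum_comm]
    refine Finset.sum_eq_zero fun l _ => ?_
    rw [← neg_zero, ← zero_mul (u l), ← h_jacobi i j k l, Finset.sum_mul,
      ← Finset.sum_neg_distrib]
    refine Finset.sum_congr rfl fun s _ => ?_
    rw [hc_skew i s l, hc_skew j s l, hc_skew k s l]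
    ring
  calc _ = _ := Finset.sum_congr rfl fun s _ => by ring
    _ = (∑ s, ((∑ l, c i s l * u l) * c j k s + (∑ l, c j s l * u l) * c k i s
      + (∑ l, c k s l * u l) * c i j s))
      + ∑ s, (f i s * c j k s + f j s * c k i s + f k s * c i j s) := Finset.sum_add_distrib
    _ = 0 := by rw [h, h_cocycle, add_zero]

/-- Partial derivatives of an affine function. -/
lemma pd_sum_mul_affine {n : ℕ} {ι : Type*} [Fintype ι] (w f : ι → ℝ) (c : ι → Fin n → ℝ)
    (s : Fin n) (u : Fin n → ℝ) :
    pd s (fun v => ∑ t, w t * ((∑ l, c t l * v l) + f t)) u = ∑ t, w t * c t s := by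
  have h : HasFDerivAt (fun v : Fin n → ℝ => ∑ t, w t * ((∑ l, c t l * v l) + f t))
      (∑ t, w t • ∑ l, c t l • ContinuousLinearMap.proj (R := ℝ) (φ := fun _ : Fin n => ℝ) l)
      u := by
    refine HasFDerivAt.fun_sum fun t _ => HasFDerivAt.const_mul (HasFDerivAt.add_const _
      (HasFDerivAt.fun_sum fun l _ => HasFDerivAt.const_mul (hasFDerivAt_apply l u) _)) _
  rw [pd, h.fderiv]
  simp [Pi.single_apply]

/-- Raising both lower indices of the Nijenhuis torsion (with `M` the affine bracket and
`ginv * M` the affinor) leaves `∑ s, M k s * c a b s`. -/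
lemma raised_torsion_eq {ι : Type*} [Fintype ι] [DecidableEq ι] {g ginv M : Matrix ι ι ℝ}
    {c : ι → ι → ι → ℝ}
    (hg_symm : ∀ i j, g i j = g j i) (hg_inv : g * ginv = 1)
    (hc_skew : ∀ i j k, c i j k = - c j i k) (hM_skew : ∀ i j, M i j = - M j i)
    (h_compat : ∀ i j k, ∑ s, (g i s * c j k s + g j s * c i k s) = 0)
    (hM : ∀ i j k, ∑ s, (M i s * c j k s + M j s * c k i s + M k s * c i j s) = 0) (k : ι) :
    g * (Matrix.of fun i j => ∑ s, ((ginv * M) i s * (∑ t, ginv j t * c t k s)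
        - (ginv * M) j s * (∑ t, ginv i t * c t k s)
        + (ginv * M) s k * (∑ t, ginv i t * c t s j)
        - (ginv * M) s k * (∑ t, ginv j t * c t s i))) * g.transpose
      = Matrix.of fun a b => ∑ s, M k s * c a b s := by
  let C : Matrix ι ι ℝ := Matrix.of fun a s => c a k s
  let X : Matrix ι ι ℝ := Matrix.of fun a j => ∑ s, (ginv * M) s k * c a s j
  have hg_inv_transpose : ginv.transpose * g.transpose = 1 := by
    rw [← Matrix.transpose_mul, hg_inv, Matrix.transpose_one]
  have hN : (Matrix.of fun i j => ∑ s, ((ginv * M) i s * (∑ t, ginv j t * c t k s)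
        - (ginv * M) j s * (∑ t, ginv i t * c t k s)
        + (ginv * M) s k * (∑ t, ginv i t * c t s j)
        - (ginv * M) s k * (∑ t, ginv j t * c t s i)))
      = ginv * M * (ginv * C).transpose - (ginv * M * (ginv * C).transpose).transpose
        + ginv * X - (ginv * X).transpose := by
    have hX (i j : ι) : (ginv * X) i j = ∑ s, (ginv * M) s k * ∑ t, ginv i t * c t s j := by
      simp only [X, Matrix.mul_apply (M := ginv) (N := Matrix.of _), Matrix.of_apply,
        Finset.mul_sum]
      rw [Finset.sum_comm]
      exact Finset.sum_congr rfl fun s _ => Finset.sum_congr rfl fun t _ => by ring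
    ext i j
    simp only [Matrix.sub_apply, Matrix.add_apply, Matrix.transpose_apply, hX]
    simp only [Matrix.of_apply, Finset.sum_sub_distrib, Finset.sum_add_distrib]
    rw [Matrix.mul_apply (M := ginv * M), Matrix.mul_apply (M := ginv * M)]
    simp only [Matrix.transpose_apply, Matrix.mul_apply (M := ginv) (N := C)]
    rfl
  have hXg (a b : ι) : (X * g.transpose) a b = ∑ s, M s k * c b a s := by
    calc (X * g.transpose) a b = ∑ s, (ginv * M) s k * ∑ m, g b m * c a s m := by
          simp only [Matrix.mul_apply (M := X), X, Matrix.of_apply, Matrix.transpose_apply,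
            Finset.sum_mul, Finset.mul_sum]
          rw [Finset.sum_comm]
          exact Finset.sum_congr rfl fun s _ => Finset.sum_congr rfl fun t _ => by ring
      _ = ∑ m, (g * (ginv * M)) m k * c b a m := by
          simp only [sum_mul_structureConst_cyclic hc_skew h_compat a b, Finset.mul_sum,
            Matrix.mul_apply (M := g), Finset.sum_mul]
          rw [Finset.sum_comm]
          exact Finset.sum_congr rfl fun s _ => Finset.sum_congr rfl fun t _ => by
            rw [hg_symm s t]; ring
      _ = _ := by rw [← Matrix.mul_assoc, hg_inv, Matrix.one_mul]
  have hraise : g * (ginv * M * (ginv * C).transpose - (ginv * M * (ginv * C).transpose).transpose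
        + ginv * X - (ginv * X).transpose) * g.transpose
      = M * C.transpose - (M * C.transpose).transpose + X * g.transpose
        - (X * g.transpose).transpose := by
    have h (A : Matrix ι ι ℝ) : g * (ginv * A) = A := by
      rw [← Matrix.mul_assoc, hg_inv, Matrix.one_mul]
    simp only [Matrix.mul_sub, Matrix.sub_mul, Matrix.mul_add, Matrix.add_mul,
      Matrix.transpose_mul, Matrix.transpose_transpose, Matrix.mul_assoc, hg_inv_transpose,
      Matrix.mul_one, h]
  rw [hN, hraise]
  ext a b
  have h := hM a b k
  simp only [Matrix.sub_apply, Matrix.add_apply, Matrix.transpose_apply, hXg,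
    Matrix.mul_apply, C, Matrix.of_apply]
  rw [← sub_eq_zero, ← h, ← Finset.sum_sub_distrib, ← Finset.sum_add_distrib,
    ← Finset.sum_sub_distrib, ← Finset.sum_sub_distrib]
  refine Finset.sum_congr rfl fun s _ => ?_
  rw [hc_skew b a s, hc_skew a k s, hM_skew s k]
  ring

/-- Theorem (Nijenhuis torsion of the affinor `L^i_j = g_{js}(c^{si}_ℓ u^ℓ + f^{si})`). -/
theorem nijenhuis_torsion_vanishes_iff
    (n : ℕ) (hn : 1 ≤ n)
    (g ginv : Matrix (Fin n) (Fin n) ℝ)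
    (hg_symm : ∀ i j, g i j = g j i)
    (hg_inv : g * ginv = 1) (hg_inv' : ginv * g = 1)
    (c : Fin n → Fin n → Fin n → ℝ) (f : Fin n → Fin n → ℝ)
    (hc_skew : ∀ i j k, c i j k = - c j i k)
    (hf_skew : ∀ i j, f i j = - f j i)
    (h_jacobi : ∀ i j k l,
      ∑ s, (c i j s * c s k l + c j k s * c s i l + c k i s * c s j l) = 0)
    (h_cocycle : ∀ i j k,
      ∑ s, (f i s * c j k s + f j s * c k i s + f k s * c i j s) = 0)
    (h_compat : ∀ i j k, ∑ s, (g i s * c j k s + g j s * c i k s) = 0)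
    (L : Fin n → Fin n → (Fin n → ℝ) → ℝ)
    (hL : ∀ i j u, L i j u = ∑ s, ginv j s * ((∑ l, c s i l * u l) + f s i)) :
    (∀ (u : Fin n → ℝ) (i j k : Fin n),
        ∑ s, (L s i u * pd s (L k j) u - L s j u * pd s (L k i) u
          + L k s u * pd j (L s i) u - L k s u * pd i (L s j) u) = 0)
      ↔ ((∀ i j k l, ∑ s, c i s j * c k l s = 0)
          ∧ (∀ i j k, ∑ s, f i s * c j k s = 0)) := by
  let M (u : Fin n → ℝ) : Matrix (Fin n) (Fin n) ℝ :=
    Matrix.of fun i j => (∑ l, c i j l * u l) + f i j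
  have hLM (i j u) : L i j u = (ginv * M u) j i := hL i j u
  have hpd (s i j u) : pd s (L i j) u = ∑ t, ginv j t * c t i s := by
    rw [funext (hL i j)]
    exact pd_sum_mul_affine (ginv j) (fun t => f t i) (fun t => c t i) s u
  have hM_skew (u i j) : M u i j = - M u j i := by
    simp only [M, Matrix.of_apply, neg_add, ← Finset.sum_neg_distrib]
    rw [hf_skew i j]
    congr 1
    exact Finset.sum_congr rfl fun l _ => by rw [hc_skew i j l]; ring
  have hraised (u k) := raised_torsion_eq hg_symm hg_inv hc_skew (hM_skew u) h_compat
    (affine_bracket_cocycle hc_skew h_jacobi h_cocycle u) k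
  simp only [hLM, hpd]
  have hg_inv_transpose : g.transpose * ginv.transpose = 1 := by
    rw [← Matrix.transpose_mul, hg_inv', Matrix.transpose_one]
  constructor
  · intro hN
    have hT (u k a b) : ∑ s, M u k s * c a b s = 0 := by
      have h := hraised u k
      simp only [hN] at h
      have h' := congrFun₂ h.symm a b
      rw [show (Matrix.of fun _ _ : Fin n => (0 : ℝ)) = 0 from rfl, Matrix.mul_zero,
        Matrix.zero_mul] at h'
      exact h'
    have hf (i j k) : ∑ s, f i s * c j k s = 0 := by
      simpa [M] using hT 0 i j k
    refine ⟨fun i j k l => ?_, hf⟩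
    have h := hT (Pi.single j 1) i k l
    simpa [M, Pi.single_apply, add_mul, Finset.sum_add_distrib, hf] using h
  · rintro ⟨hcc, hfc⟩ u i j k
    have hT (a b) : ∑ s, M u k s * c a b s = 0 := by
      simp only [M, Matrix.of_apply, add_mul, Finset.sum_add_distrib, hfc, add_zero,
        Finset.sum_mul]
      rw [Finset.sum_comm]
      refine Finset.sum_eq_zero fun l _ => ?_
      rw [← zero_mul (u l), ← hcc k l a b, Finset.sum_mul]
      exact Finset.sum_congr rfl fun s _ => by ring
    have h := hraised u k
    simp only [hT] at h
    have h' := congrArg (fun A => ginv * A * ginv.transpose) h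
    simp only [Matrix.mul_assoc, hg_inv_transpose, Matrix.mul_one] at h'
    rw [← Matrix.mul_assoc, hg_inv', Matrix.one_mul,
      show (Matrix.of fun _ _ : Fin n => (0 : ℝ)) = 0 from rfl, Matrix.zero_mul,
      Matrix.mul_zero] at h'
    exact congrFun₂ h' i j
end

section
/- Let a, b, c ∈ {−1, 1} and c₁, c₂, c₃, c₄ ∈ ℝ. Let h¹, h², h³, ω₁, ω₂, ω₃ : ℝ³ → ℝ be smooth in the coordinates (u,v,w). Define Ω₁ := (c₃ − (c c₁ / b) v) ∂h²/∂w − ((c c₁ / a) u + c₄) ∂h¹/∂w − c₁ h³ + (c₂ + c₁ w)(∂h²/∂v + ∂h¹/∂u); Ω₂ := (c₃ − (c c₁ / b) v)(∂h¹/∂u + ∂h³/∂w) + (c₂ + c₁ w) ∂h³/∂v + ((c c₁ / a) u + c₄) ∂h¹/∂v + (c c₁ / b) h²; Ω₃ := (c₃ − (c c₁ / b) v) ∂h²/∂u − (c₂ + c₁ w) ∂h³/∂u − (c c₁ / a) h¹ + ((c c₁ / a) u + c₄)(∂h²/∂v + ∂h³/∂w). Assume the compatibility conditions P^{ijk} =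 0 hold, which unfold to: ∂(ω₁ − Ω₁)/∂u = ∂(ω₁ − Ω₁)/∂v = 0, ∂(ω₂ − Ω₂)/∂u = ∂(ω₂ − Ω₂)/∂w = 0, ∂(ω₃ − Ω₃)/∂v = ∂(ω₃ − Ω₃)/∂w = 0, together with c · ∂(ω₁ − Ω₁)/∂w = a · ∂(ω₃ − Ω₃)/∂u and b · ∂(ω₂ − Ω₂)/∂v = −a · ∂(ω₃ − Ω₃)/∂u everywhere on ℝ³. Then there exist constants k, k₁, k₂, k₃ ∈ ℝ such that ω₁ = Ω₁ + k w + k₁, ω₂ = Ω₂ − (c k / b) v + k₂, and ω₃ = Ω₃ + (c k / a) u + k₃ on all of ℝ³. -/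
open scoped BigOperators

theorem pd_differentiable {n : ℕ} (i : Fin n) {f : (Fin n → ℝ) → ℝ}
    (hf : ContDiff ℝ (⊤ : ℕ∞) f) : Differentiable ℝ (pd i f) := by
  have h : ContDiff ℝ (⊤ : ℕ∞) (fderiv ℝ f) := hf.fderiv_right le_rfl
  exact (h.differentiable (by simp)).clm_apply (differentiable_const _)

theorem fderiv_apply_eq_sum_pd {n : ℕ} (f : (Fin n → ℝ) → ℝ) (x v : Fin n → ℝ) :
    fderiv ℝ f x v = ∑ i, v i * pd i f x := by
  conv_lhs => rw [pi_eq_sum_univ' v, map_sum]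
  refine Finset.sum_congr rfl fun i _ => ?_
  have hi : (fun j => if i = j then (1 : ℝ) else 0) = Pi.single i 1 := by
    ext j
    simp [Pi.single_apply, eq_comm]
  rw [map_smul, smul_eq_mul, pd, ← hi]

/-- A function whose partial derivatives vanish except in direction `j` depends only on the
`j`-th coordinate. -/
theorem eq_apply_single_of_pd_eq_zero {n : ℕ} (j : Fin n) {f : (Fin n → ℝ) → ℝ}
    (hf : Differentiable ℝ f) (h : ∀ i, i ≠ j → ∀ x, pd i f x = 0) (x : Fin n → ℝ) :
    f x = f (Pi.single j (x j)) := by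
  set p : Fin n → ℝ := Pi.single j (x j) with hp
  have hline (t : ℝ) : HasDerivAt (fun s : ℝ => f (p + s • (x - p))) 0 t := by
    have h₁ : HasDerivAt (fun s : ℝ => p + s • (x - p)) (x - p) t := by
      simpa using ((hasDerivAt_id t).smul_const (x - p)).const_add p
    have h₂ := (hf (p + t • (x - p))).hasFDerivAt.comp_hasDerivAt t h₁
    rw [fderiv_apply_eq_sum_pd, Finset.sum_eq_zero] at h₂
    · exact h₂
    · intro i _
      by_cases hij : i = j
      · subst hij
        simp [hp]
      · rw [h i hij, mul_zero]
  have := is_const_of_deriv_eq_zero (fun t => (hline t).differentiableAt)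
    (fun t => (hline t).deriv) 1 0
  simpa using this

theorem pd_eq_pd_single_of_pd_eq_zero {n : ℕ} (j : Fin n) {f : (Fin n → ℝ) → ℝ}
    (hf : Differentiable ℝ f) (h : ∀ i, i ≠ j → ∀ x, pd i f x = 0) (x : Fin n → ℝ) :
    pd j f x = pd j f (Pi.single j (x j)) := by
  let L : (Fin n → ℝ) →L[ℝ] (Fin n → ℝ) :=
    (ContinuousLinearMap.single ℝ (fun _ : Fin n => ℝ) j).comp (ContinuousLinearMap.proj j)
  have hfL : f = f ∘ L := funext fun y => eq_apply_single_of_pd_eq_zero j hf h y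
  have hd : fderiv ℝ f x = (fderiv ℝ f (L x)).comp L := by
    conv_lhs => rw [hfL]
    exact ((hf (L x)).hasFDerivAt.comp x L.hasFDerivAt).fderiv
  have hLx : L x = Pi.single j (x j) := rfl
  have hLe : L (Pi.single j 1) = Pi.single j 1 := by simp [L]
  rw [pd, pd, hd, ContinuousLinearMap.comp_apply, hLe, hLx]

theorem eq_sum_add_of_pd_eq_const {n : ℕ} {f : (Fin n → ℝ) → ℝ} (hf : Differentiable ℝ f)
    (k : Fin n → ℝ) (h : ∀ i x, pd i f x = k i) (x : Fin n → ℝ) :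
    f x = ∑ i, x i * k i + f 0 := by
  have hd (y : Fin n → ℝ) : HasFDerivAt (fun z => f z - fderiv ℝ f 0 z)
      (0 : (Fin n → ℝ) →L[ℝ] ℝ) y := by
    have h₁ : fderiv ℝ f y = fderiv ℝ f 0 := by
      ext v
      simp only [fderiv_apply_eq_sum_pd, h]
    have h₂ := (hf y).hasFDerivAt.sub (fderiv ℝ f 0).hasFDerivAt
    rw [h₁, sub_self] at h₂
    exact h₂
  have h₀ := is_const_of_fderiv_eq_zero (𝕜 := ℝ) (fun y => (hd y).differentiableAt)
    (fun y => (hd y).fderiv) x 0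
  simp only [map_zero, sub_zero, fderiv_apply_eq_sum_pd, h] at h₀
  linarith

/-- Form of the ultralocal term of the second operator of a compatible pair in three
components.  Coordinates: index `0` is `u`, index `1` is `v`, index `2` is `w`. -/
theorem ultralocal_form_three_components
    (a b c : ℝ) (ha : a = -1 ∨ a = 1) (hb : b = -1 ∨ b = 1) (hc : c = -1 ∨ c = 1)
    (c₁ c₂ c₃ c₄ : ℝ)
    (h1 h2 h3 ω1 ω2 ω3 : (Fin 3 → ℝ) → ℝ)
    (hh1 : ContDiff ℝ (⊤ : ℕ∞) h1) (hh2 : ContDiff ℝ (⊤ : ℕ∞) h2) (hh3 : ContDiff ℝ (⊤ : ℕ∞) h3)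
    (hω1 : ContDiff ℝ (⊤ : ℕ∞) ω1) (hω2 : ContDiff ℝ (⊤ : ℕ∞) ω2) (hω3 : ContDiff ℝ (⊤ : ℕ∞) ω3)
    (Ω1 Ω2 Ω3 : (Fin 3 → ℝ) → ℝ)
    (hΩ1 : ∀ x, Ω1 x =
      (c₃ - (c * c₁ / b) * x 1) * pd 2 h2 x
        - ((c * c₁ / a) * x 0 + c₄) * pd 2 h1 x
        - c₁ * h3 x
        + (c₂ + c₁ * x 2) * (pd 1 h2 x + pd 0 h1 x))
    (hΩ2 : ∀ x, Ω2 x =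
      (c₃ - (c * c₁ / b) * x 1) * (pd 0 h1 x + pd 2 h3 x)
        + (c₂ + c₁ * x 2) * pd 1 h3 x
        + ((c * c₁ / a) * x 0 + c₄) * pd 1 h1 x
        + (c * c₁ / b) * h2 x)
    (hΩ3 : ∀ x, Ω3 x =
      (c₃ - (c * c₁ / b) * x 1) * pd 0 h2 x
        - (c₂ + c₁ * x 2) * pd 0 h3 x
        - (c * c₁ / a) * h1 x
        + ((c * c₁ / a) * x 0 + c₄) * (pd 1 h2 x + pd 2 h3 x))
    (hP1u : ∀ x, pd 0 (fun y => ω1 y - Ω1 y) x = 0)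
    (hP1v : ∀ x, pd 1 (fun y => ω1 y - Ω1 y) x = 0)
    (hP2u : ∀ x, pd 0 (fun y => ω2 y - Ω2 y) x = 0)
    (hP2w : ∀ x, pd 2 (fun y => ω2 y - Ω2 y) x = 0)
    (hP3v : ∀ x, pd 1 (fun y => ω3 y - Ω3 y) x = 0)
    (hP3w : ∀ x, pd 2 (fun y => ω3 y - Ω3 y) x = 0)
    (hP13 : ∀ x, c * pd 2 (fun y => ω1 y - Ω1 y) x = a * pd 0 (fun y => ω3 y - Ω3 y) x)
    (hP23 : ∀ x, b * pd 1 (fun y => ω2 y - Ω2 y) x = - a * pd 0 (fun y => ω3 y - Ω3 y) x) :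
    ∃ k k₁ k₂ k₃ : ℝ, ∀ x : Fin 3 → ℝ,
      ω1 x = Ω1 x + k * x 2 + k₁
        ∧ ω2 x = Ω2 x - (c * k / b) * x 1 + k₂
        ∧ ω3 x = Ω3 x + (c * k / a) * x 0 + k₃ := by
  have ha0 : a ≠ 0 := by rcases ha with rfl | rfl <;> norm_num
  have hb0 : b ≠ 0 := by rcases hb with rfl | rfl <;> norm_num
  have hc0 : c ≠ 0 := by rcases hc with rfl | rfl <;> norm_num
  have d1 := hh1.differentiable (by simp)
  have d2 := hh2.differentiable (by simp)
  have d3 := hh3.differentiable (by simp)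
  have p1 := fun i => pd_differentiable i hh1
  have p2 := fun i => pd_differentiable i hh2
  have p3 := fun i => pd_differentiable i hh3
  have hf : Differentiable ℝ (fun y => ω1 y - Ω1 y) := by
    refine (hω1.differentiable (by simp)).sub ?_
    rw [funext hΩ1]
    have := p2 2; have := p1 2; have := p2 1; have := p1 0
    fun_prop
  have hg : Differentiable ℝ (fun y => ω2 y - Ω2 y) := by
    refine (hω2.differentiable (by simp)).sub ?_
    rw [funext hΩ2]
    have := p1 0; have := p3 2; have := p3 1; have := p1 1
    fun_prop
  have he : Differentiable ℝ (fun y => ω3 y - Ω3 y) := by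
    refine (hω3.differentiable (by simp)).sub ?_
    rw [funext hΩ3]
    have := p2 0; have := p3 0; have := p2 1; have := p3 2
    fun_prop
  generalize hF : (fun y => ω1 y - Ω1 y) = F at *
  generalize hG : (fun y => ω2 y - Ω2 y) = G at *
  generalize hE : (fun y => ω3 y - Ω3 y) = E at *
  have hF0 : ∀ i, i ≠ 2 → ∀ x, pd i F x = 0 := by
    intro i hi
    fin_cases i
    exacts [hP1u, hP1v, absurd rfl hi]
  have hE0 : ∀ i, i ≠ 0 → ∀ x, pd i E x = 0 := by
    intro i hi
    fin_cases i
    exacts [absurd rfl hi, hP3v, hP3w]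
  have hFk (x : Fin 3 → ℝ) : pd 2 F x = pd 2 F 0 := by
    have h₁ := pd_eq_pd_single_of_pd_eq_zero 2 hf hF0 x
    have h₂ := pd_eq_pd_single_of_pd_eq_zero 0 he hE0 (Pi.single 2 (x 2))
    have h₃ : (Pi.single 2 (x 2) : Fin 3 → ℝ) 0 = 0 := by simp
    rw [h₃, Pi.single_zero] at h₂
    refine mul_left_cancel₀ hc0 ?_
    rw [h₁, hP13, h₂, hP13]
  have hEk (x : Fin 3 → ℝ) : pd 0 E x = c * pd 2 F 0 / a := by
    rw [eq_div_iff ha0, ← hFk x, hP13, mul_comm]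
  have hGk (x : Fin 3 → ℝ) : pd 1 G x = -(c * pd 2 F 0 / b) := by
    have h₁ := hP23 x
    have h₂ := hP13 x
    rw [hFk] at h₂
    field_simp
    linarith
  refine ⟨pd 2 F 0, F 0, G 0, E 0, fun x => ?_⟩
  have rF := eq_sum_add_of_pd_eq_const hf ![0, 0, pd 2 F 0]
    (by intro i; fin_cases i; exacts [hP1u, hP1v, hFk]) x
  have rG := eq_sum_add_of_pd_eq_const hg ![0, -(c * pd 2 F 0 / b), 0]
    (by intro i; fin_cases i; exacts [hP2u, hGk, hP2w]) x
  have rE := eq_sum_add_of_pd_eq_const he ![c * pd 2 F 0 / a, 0, 0]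
    (by intro i; fin_cases i; exacts [hEk, hP3v, hP3w]) x
  simp only [Fin.sum_univ_three, Matrix.cons_val] at rF rG rE
  have eF := congrFun hF x
  have eG := congrFun hG x
  have eE := congrFun hE x
  refine ⟨?_, ?_, ?_⟩ <;> linarith
end

section
/- Let a, b, c be real numbers with a ≠ 0, b ≠ 0, c ≠ 0, let c₁ ∈ ℝ, and let h¹, h², ω : ℝ² → ℝ be smooth functions of (u,v) satisfying, everywhere on ℝ²: a ∂h²/∂u + b ∂h¹/∂v = 0, ∂h²/∂v − ∂h¹/∂u = c₁, ∂²h¹/∂u² + ∂²h²/∂u∂v = 0, and c ( ∂²h¹/∂u∂v + ∂²h²/∂v² ) = ∂ω/∂v. Then everywhere on ℝ²: ∂²h²/∂u∂v = ∂²h¹/∂u² = ∂²h¹/∂v² = 0, and ∂²h²/∂v² = ∂²h¹/∂u∂v = −(a/b) ∂²h²/∂u² = (1/(2c)) ∂ω/∂v. -/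
open scoped BigOperators

theorem differentiable_fderiv_of_contDiff_two {n : ℕ} {f : (Fin n → ℝ) → ℝ}
    (hf : ContDiff ℝ 2 f) : Differentiable ℝ (fderiv ℝ f) :=
  (hf.fderiv_right (m := 1) (by norm_num)).differentiable (by norm_num)

theorem differentiable_pd {n : ℕ} (i : Fin n) {f : (Fin n → ℝ) → ℝ}
    (hf : ContDiff ℝ 2 f) : Differentiable ℝ (pd i f) :=
  fun x => (differentiable_fderiv_of_contDiff_two hf x).clm_apply (differentiableAt_const _)

theorem pd_pd_apply {n : ℕ} (i j : Fin n) {f : (Fin n → ℝ) → ℝ}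
    (hf : ContDiff ℝ 2 f) (x : Fin n → ℝ) :
    pd i (pd j f) x = fderiv ℝ (fderiv ℝ f) x (Pi.single i 1) (Pi.single j 1) := by
  unfold pd
  rw [fderiv_clm_apply (differentiable_fderiv_of_contDiff_two hf x) (differentiableAt_const _)]
  simp

theorem pd_comm {n : ℕ} (i j : Fin n) {f : (Fin n → ℝ) → ℝ}
    (hf : ContDiff ℝ 2 f) (x : Fin n → ℝ) :
    pd i (pd j f) x = pd j (pd i f) x := by
  rw [pd_pd_apply i j hf, pd_pd_apply j i hf]
  exact (hf.contDiffAt.isSymmSndFDerivAt (by simp)) _ _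

/-- A constant linear combination of two functions has vanishing derivative. -/
theorem pd_linear_relation {n : ℕ} (i : Fin n) {f g : (Fin n → ℝ) → ℝ}
    (hf : Differentiable ℝ f) (hg : Differentiable ℝ g) {a b k : ℝ}
    (h : ∀ x, a * f x + b * g x = k) (x : Fin n → ℝ) :
    a * pd i f x + b * pd i g x = 0 := by
  have hd := ((hf x).hasFDerivAt.const_mul a).add ((hg x).hasFDerivAt.const_mul b)
  have hk : HasFDerivAt (fun y => a * f y + b * g y) (0 : (Fin n → ℝ) →L[ℝ] ℝ) x := by
    simpa only [h] using hasFDerivAt_const k x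
  simpa [pd] using congrArg (fun L => L (Pi.single i 1)) (hd.unique hk)

/-- Case `ω_u = 0, ω_v ≠ 0` of the two-component classification: the derived
second-order relations on the potentials.  Coordinates: index `0` is `u`,
index `1` is `v`. -/
theorem potentials_second_order_relations
    (a b c : ℝ) (ha : a ≠ 0) (hb : b ≠ 0) (hc : c ≠ 0) (c₁ : ℝ)
    (h1 h2 ω : (Fin 2 → ℝ) → ℝ)
    (hh1 : ContDiff ℝ (⊤ : ℕ∞) h1) (hh2 : ContDiff ℝ (⊤ : ℕ∞) h2) (hω : ContDiff ℝ (⊤ : ℕ∞) ω)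
    (e1 : ∀ x, a * pd 0 h2 x + b * pd 1 h1 x = 0)
    (e2 : ∀ x, pd 1 h2 x - pd 0 h1 x = c₁)
    (e3 : ∀ x, pd 0 (pd 0 h1) x + pd 0 (pd 1 h2) x = 0)
    (e4 : ∀ x, c * (pd 1 (pd 0 h1) x + pd 1 (pd 1 h2) x) = pd 1 ω x) :
    ∀ x : Fin 2 → ℝ,
      pd 0 (pd 1 h2) x = 0
        ∧ pd 0 (pd 0 h1) x = 0
        ∧ pd 1 (pd 1 h1) x = 0
        ∧ pd 1 (pd 1 h2) x = pd 0 (pd 1 h1) x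
        ∧ pd 0 (pd 1 h1) x = -(a / b) * pd 0 (pd 0 h2) x
        ∧ -(a / b) * pd 0 (pd 0 h2) x = (1 / (2 * c)) * pd 1 ω x := by
  intro x
  have two_le : (2 : WithTop ℕ∞) ≤ ((⊤ : ℕ∞) : WithTop ℕ∞) :=
    WithTop.coe_le_coe.mpr (le_top : (2 : ℕ∞) ≤ ⊤)
  replace hh1 := hh1.of_le two_le
  replace hh2 := hh2.of_le two_le
  have d1 (i : Fin 2) := pd_linear_relation i (differentiable_pd 0 hh2) (differentiable_pd 1 hh1) e1 x
  have d2 (i : Fin 2) := pd_linear_relation i (differentiable_pd 1 hh2) (differentiable_pd 0 hh1)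
    (a := 1) (b := -1) (k := c₁) (fun y => by linarith [e2 y]) x
  have s1 := pd_comm 1 0 hh1 x
  have s2 := pd_comm 1 0 hh2 x
  have huv : pd 0 (pd 1 h2) x = 0 := by linarith [d2 0, e3 x]
  have huu : pd 0 (pd 0 h1) x = 0 := by linarith [e3 x]
  have hvv : pd 1 (pd 1 h2) x = pd 0 (pd 1 h1) x := by linarith [d2 1]
  have hmix : pd 0 (pd 1 h1) x = -(a / b) * pd 0 (pd 0 h2) x := by
    field_simp
    linarith [d1 0]
  refine ⟨huv, huu, ?_, hvv, hmix, ?_⟩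
  · have h := d1 1
    rw [s2, huv, mul_zero, zero_add] at h
    exact (mul_eq_zero.mp h).resolve_left hb
  · rw [← hmix, ← e4 x, s1, hvv]
    field_simp
    ring
end

section
/- Let a, b ∈ {−1, 1} with a·b > 0 (so a = b). Let Ω ⊆ ℝ² be open and let h¹, h², ω : Ω → ℝ be smooth functions of (u,v) such that at every point of Ω one has ∂ω/∂u ≠ 0 and ∂ω/∂v ≠ 0, and the two equations ( a ∂h²/∂u + b ∂h¹/∂v ) ∂ω/∂v + a ( ∂h¹/∂u − ∂h²/∂v ) ∂ω/∂u = 0 and ( a ∂h²/∂u + b ∂h¹/∂v ) ∂ω/∂u + b ( ∂h²/∂v − ∂h¹/∂u ) ∂ω/∂v = 0 hold. Then at every point of Ω the Cauchy–Riemann system holds: ∂h²/∂v = ∂h¹/∂u and ∂h²/∂u + ∂h¹/∂v = 0. -/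
open scoped BigOperators

/-- When `ab > 0` and both derivatives of `ω` are nonzero, the symmetry conditions
force the Cauchy–Riemann system for `h¹, h²`.  Coordinates: index `0` is `u`,
index `1` is `v`. -/
theorem symmetry_conditions_force_cauchy_riemann
    (a b : ℝ) (ha : a = -1 ∨ a = 1) (hb : b = -1 ∨ b = 1) (hab : a * b > 0)
    (Ω : Set (Fin 2 → ℝ)) (hΩ_open : IsOpen Ω)
    (h1 h2 ω : (Fin 2 → ℝ) → ℝ)
    (hh1 : ContDiffOn ℝ (⊤ : ℕ∞) h1 Ω) (hh2 : ContDiffOn ℝ (⊤ : ℕ∞) h2 Ω) (hω : ContDiffOn ℝ (⊤ : ℕ∞) ω Ω)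
    (hωu : ∀ x ∈ Ω, pd 0 ω x ≠ 0)
    (hωv : ∀ x ∈ Ω, pd 1 ω x ≠ 0)
    (e1 : ∀ x ∈ Ω,
      (a * pd 0 h2 x + b * pd 1 h1 x) * pd 1 ω x
        + a * (pd 0 h1 x - pd 1 h2 x) * pd 0 ω x = 0)
    (e2 : ∀ x ∈ Ω,
      (a * pd 0 h2 x + b * pd 1 h1 x) * pd 0 ω x
        + b * (pd 1 h2 x - pd 0 h1 x) * pd 1 ω x = 0) :
    ∀ x ∈ Ω, pd 1 h2 x = pd 0 h1 x ∧ pd 0 h2 x + pd 1 h1 x = 0 := by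
  intro x hx
  have key : ∀ {S D p q : ℝ}, p ≠ 0 → S * q + D * p = 0 → S * p - D * q = 0 →
      D = 0 ∧ S = 0 := by
    intro S D p q hp h h'
    have hpq : p ^ 2 + q ^ 2 ≠ 0 := by positivity
    constructor
    · refine (mul_eq_zero.mp ?_).resolve_right hpq
      linear_combination p * h - q * h'
    · refine (mul_eq_zero.mp ?_).resolve_right hpq
      linear_combination q * h + p * h'
  have hsq : a * a = 1 := by rcases ha with rfl | rfl <;> norm_num
  obtain rfl : a = b := by
    rcases ha with rfl | rfl <;> rcases hb with rfl | rfl <;> first | rfl | norm_num at hab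
  obtain ⟨hD, hS⟩ := key (S := pd 0 h2 x + pd 1 h1 x) (D := pd 0 h1 x - pd 1 h2 x)
    (p := pd 0 ω x) (q := pd 1 ω x) (hωu x hx)
    (by linear_combination a * e1 x hx - ((pd 0 h2 x + pd 1 h1 x) * pd 1 ω x +
      (pd 0 h1 x - pd 1 h2 x) * pd 0 ω x) * hsq)
    (by linear_combination a * e2 x hx - ((pd 0 h2 x + pd 1 h1 x) * pd 0 ω x -
      (pd 0 h1 x - pd 1 h2 x) * pd 1 ω x) * hsq)
  exact ⟨(sub_eq_zero.mp hD).symm, hS⟩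
end

section
/- Let ℓ : ℝ → ℝ be smooth, let h : ℝ² → ℝ be a smooth nowhere-vanishing function of (v,w), and set g(v,w) = ℓ(v) h(v,w). Then a smooth function F : ℝ³ → ℝ of (u,v,w) satisfies the ultralocal Casimir system g(v,w) ∂F/∂w = 0, h(v,w) ∂F/∂w = 0 and g(v,w) ∂F/∂u + h(v,w) ∂F/∂v = 0 at every point of ℝ³ if and only if there exists a smooth function f₀ : ℝ → ℝ such that F(u,v,w) = f₀( u − ∫₀^v ℓ(s) ds ) for all (u,v,w) ∈ ℝ³. -/
open scoped BigOperators

/-- The value of the differential on a vector of `ℝ³` in terms of the partial derivatives. -/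
theorem fderiv_apply_eq_pd_three (F : (Fin 3 → ℝ) → ℝ) (x y : Fin 3 → ℝ) :
    fderiv ℝ F x y = y 0 * pd 0 F x + y 1 * pd 1 F x + y 2 * pd 2 F x := by
  have hy : y = y 0 • Pi.single 0 1 + y 1 • Pi.single 1 1 + y 2 • Pi.single 2 1 := by
    ext i
    fin_cases i <;> simp
  conv_lhs => rw [hy]
  simp only [map_add, map_smul, smul_eq_mul, pd]

theorem hasDerivAt_integral_zero {l : ℝ → ℝ} (hl : Continuous l) (v : ℝ) :
    HasDerivAt (fun v => ∫ s in (0:ℝ)..v, l s) (l v) v :=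
  intervalIntegral.integral_hasDerivAt_right (hl.intervalIntegrable _ _)
    (hl.stronglyMeasurableAtFilter _ _) hl.continuousAt

/-- A function on `ℝ³` annihilated by `∂_w` and `l(v) ∂_u + ∂_v` is constant along a curve
joining any point to the `u`-axis. -/
theorem eq_apply_axis_of_pd {l : ℝ → ℝ} (hl : Continuous l) {F : (Fin 3 → ℝ) → ℝ}
    (hF : Differentiable ℝ F) (hw : ∀ x, pd 2 F x = 0)
    (huv : ∀ x, l (x 1) * pd 0 F x + pd 1 F x = 0) (x : Fin 3 → ℝ) :
    F x = F ![x 0 - ∫ s in (0:ℝ)..(x 1), l s, 0, 0] := by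
  set t := x 0 - ∫ s in (0:ℝ)..(x 1), l s with ht
  let c : ℝ → Fin 3 → ℝ :=
    fun r => ![t + ∫ s in (0:ℝ)..(r * x 1), l s, r * x 1, r * x 2]
  have hlin (a r : ℝ) : HasDerivAt (fun r => r * a) a r := by
    simpa using (hasDerivAt_id r).mul_const a
  have hc (r : ℝ) : HasDerivAt c ![l (r * x 1) * x 1, x 1, x 2] r := by
    rw [hasDerivAt_pi]
    intro i
    fin_cases i
    · exact ((hasDerivAt_integral_zero hl (r * x 1)).comp r (hlin (x 1) r)).const_add t
    · exact hlin (x 1) r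
    · exact hlin (x 2) r
  have hd (r : ℝ) : HasDerivAt (F ∘ c) 0 r := by
    have key := (hF (c r)).hasFDerivAt.comp_hasDerivAt r (hc r)
    rw [fderiv_apply_eq_pd_three, hw] at key
    have hz := huv (c r)
    have hc1 : c r 1 = r * x 1 := rfl
    rw [hc1] at hz
    refine key.congr_deriv ?_
    change l (r * x 1) * x 1 * pd 0 F (c r) + x 1 * pd 1 F (c r) + x 2 * 0 = 0
    linear_combination x 1 * hz
  have h01 := is_const_of_deriv_eq_zero (fun r => (hd r).differentiableAt)
    (fun r => (hd r).deriv) 1 0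
  have h1 : c 1 = x := by
    ext i
    fin_cases i <;> simp [c, ht]
  have h0 : c 0 = ![t, 0, 0] := by
    ext i
    fin_cases i <;> simp [c]
  simpa only [Function.comp_apply, h1, h0] using h01

/-- The differential of `f₀(u - ∫₀^v l)`. -/
theorem hasFDerivAt_comp_sub_integral {l : ℝ → ℝ} (hl : Continuous l) {f₀ : ℝ → ℝ}
    (hf : Differentiable ℝ f₀) (x : Fin 3 → ℝ) :
    HasFDerivAt (fun x : Fin 3 → ℝ => f₀ (x 0 - ∫ s in (0:ℝ)..(x 1), l s))
      (deriv f₀ (x 0 - ∫ s in (0:ℝ)..(x 1), l s) •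
        (ContinuousLinearMap.proj (R := ℝ) (φ := fun _ : Fin 3 => ℝ) 0
          - l (x 1) • ContinuousLinearMap.proj (R := ℝ) (φ := fun _ : Fin 3 => ℝ) 1)) x := by
  have h1 : HasFDerivAt (fun y : Fin 3 → ℝ => ∫ s in (0:ℝ)..(y 1), l s)
      (l (x 1) • ContinuousLinearMap.proj (R := ℝ) (φ := fun _ : Fin 3 => ℝ) 1) x :=
    (hasDerivAt_integral_zero hl (x 1)).comp_hasFDerivAt (f := fun y : Fin 3 → ℝ => y 1) x
      (hasFDerivAt_apply 1 x)
  exact (hf _).hasDerivAt.comp_hasFDerivAt x ((hasFDerivAt_apply 0 x).sub h1)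

/-- Casimirs of the ultralocal part of the operator `C_{3,2}` in the case `f = 0`,
`g = ℓ(v) h(v,w)`, `h` nowhere vanishing.  Coordinates: index `0` is `u`,
index `1` is `v`, index `2` is `w`. -/
theorem ultralocal_casimir_C32_f_eq_zero
    (ℓ : ℝ → ℝ) (hℓ : ContDiff ℝ (⊤ : ℕ∞) ℓ)
    (h : ℝ → ℝ → ℝ) (hh : ContDiff ℝ (⊤ : ℕ∞) (Function.uncurry h))
    (hh_ne : ∀ v w, h v w ≠ 0)
    (g : ℝ → ℝ → ℝ) (hg : ∀ v w, g v w = ℓ v * h v w)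
    (F : (Fin 3 → ℝ) → ℝ) (hF : ContDiff ℝ (⊤ : ℕ∞) F) :
    ((∀ x : Fin 3 → ℝ, g (x 1) (x 2) * pd 2 F x = 0)
      ∧ (∀ x : Fin 3 → ℝ, h (x 1) (x 2) * pd 2 F x = 0)
      ∧ (∀ x : Fin 3 → ℝ, g (x 1) (x 2) * pd 0 F x + h (x 1) (x 2) * pd 1 F x = 0))
      ↔ ∃ f₀ : ℝ → ℝ, ContDiff ℝ (⊤ : ℕ∞) f₀ ∧
          ∀ x : Fin 3 → ℝ, F x = f₀ (x 0 - ∫ s in (0:ℝ)..(x 1), ℓ s) := by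
  constructor
  · rintro ⟨-, h2, h3⟩
    have hw (x) : pd 2 F x = 0 := (mul_eq_zero.mp (h2 x)).resolve_left (hh_ne _ _)
    have huv (x) : ℓ (x 1) * pd 0 F x + pd 1 F x = 0 := by
      refine (mul_eq_zero.mp ?_).resolve_left (hh_ne (x 1) (x 2))
      rw [← h3 x, hg]
      ring
    refine ⟨fun t => F ![t, 0, 0], hF.comp (contDiff_pi.mpr fun i => ?_),
      eq_apply_axis_of_pd hℓ.continuous (hF.differentiable (by simp)) hw huv⟩
    fin_cases i
    · exact contDiff_id
    · exact contDiff_const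
    · exact contDiff_const
  · rintro ⟨f₀, hf₀, hFf⟩
    obtain rfl : F = _ := funext hFf
    have hd (x) := (hasFDerivAt_comp_sub_integral hℓ.continuous
      (hf₀.differentiable (by simp)) x).fderiv
    refine ⟨fun x => ?_, fun x => ?_, fun x => ?_⟩
    · simp [pd, hd]
    · simp [pd, hd]
    · simp [pd, hd, hg]
      ring
end
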